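/- arXiv:0810.3019 — 2 statements merged into one kernel-verified Lean document; each statement's English description precedes it below -/
import Mathlib

section
/- For an integer c ≥ 2, define the sequence μ_j(c) by μ_1(c) = 1 + c and μ_{j+1}(c) = 1 + c·∏_{i=1}^j binom(μ_i(c), 2). Then for every integer d ≥ 1, the grid [μ_1(c),…,μ_d(c)] belongs to the obstruction set O(c,d); that is, it is c-guaranteed, and every grid obtained from it by decreasing one side length by 1 is not c-guaranteed. -/
/-- A point of the grid `[a 0, …, a (d-1)]`: one coordinate in `Fin (a i)` for each `i`. -/
def GridPoint (d : ℕ) (a : Fin d → ℕ) : Type := (i : Fin d) → Fin (a i)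

/-- A pair `p = (b, c)` with `b i < c i` for all `i` represents a (combinatorial) box
`∏ i, {b i, c i}`; it is a monochromatic box for the coloring `f` if `f` is constant
on the `2^d` points of the box. -/
def IsMonoBox {d : ℕ} {a : Fin d → ℕ} {c : ℕ} (f : GridPoint d a → Fin c)
    (p : GridPoint d a × GridPoint d a) : Prop :=
  (∀ i, p.1 i < p.2 i) ∧
    ∃ s : Fin c, ∀ x : GridPoint d a, (∀ i, x i = p.1 i ∨ x i = p.2 i) → f x = s

/-- The set of monochromatic boxes of a coloring `f` (each box represented uniquely
by the pair of its coordinatewise-minimal and coordinatewise-maximal corners). -/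
def monoBoxSet {d : ℕ} {a : Fin d → ℕ} {c : ℕ} (f : GridPoint d a → Fin c) :
    Set (GridPoint d a × GridPoint d a) := {p | IsMonoBox f p}

/-- The grid `[a 0, …, a (d-1)]` is `(c,t)`-guaranteed: every `c`-coloring admits at
least `t` distinct monochromatic boxes.  `c`-guaranteed means `(c,1)`-guaranteed. -/
def Guaranteed (d : ℕ) (a : Fin d → ℕ) (c t : ℕ) : Prop :=
  ∀ f : GridPoint d a → Fin c, t ≤ (monoBoxSet f).ncard

/-- Membership in the obstruction set `O(c,d)`: the grid is `c`-guaranteed and is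
minimal in the dominance order among `c`-guaranteed grids. -/
def InObstructionSet (d c : ℕ) (a : Fin d → ℕ) : Prop :=
  Guaranteed d a c 1 ∧
    ∀ b : Fin d → ℕ, (∀ i, 1 ≤ b i) → (∀ i, b i ≤ a i) → b ≠ a → ¬ Guaranteed d b c 1

/-- The product `∏ i, P i` of `d` two-element sides, viewed as an unordered box. -/
abbrev UBox (a : ℕ → ℕ) (d : ℕ) : Type :=
  (i : Fin d) → {S : Finset (Fin (a i)) // S.card = 2}

/-- The coloring `f` takes only the value `s` on the box `P`. -/
def MonoOn {d : ℕ} {a : ℕ → ℕ} {C : Type*} (f : ((i : Fin d) → Fin (a i)) → C)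
    (P : UBox a d) (s : C) : Prop :=
  ∀ x, (∀ i, x i ∈ (P i).1) → f x = s

lemma card_uBox_prod (a : ℕ → ℕ) (d c : ℕ) :
    Fintype.card (UBox a d × Fin c) = c * ∏ i : Fin d, (a i).choose 2 := by
  simp [Fintype.card_pi, Fintype.card_finset_len, mul_comm]

lemma guaranteed_one_iff (d : ℕ) (a : ℕ → ℕ) (c : ℕ) :
    Guaranteed d (fun i => a i) c 1 ↔
      ∀ f : ((i : Fin d) → Fin (a i)) → Fin c, ∃ P s, MonoOn f P s := by
  have : Finite (GridPoint d (fun i => a i)) := by unfold GridPoint; infer_instance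
  refine forall_congr' fun f => ?_
  rw [Nat.one_le_iff_ne_zero, ← Nat.pos_iff_ne_zero, Set.ncard_pos (Set.toFinite _)]
  constructor
  · rintro ⟨p, hlt, s, hs⟩
    refine ⟨fun i => ⟨{p.1 i, p.2 i}, Finset.card_pair (hlt i).ne⟩, s, fun x hx => hs x fun i => ?_⟩
    simpa using hx i
  · rintro ⟨P, s, hs⟩
    have key : ∀ i, ∃ u v, u < v ∧ (P i).1 = {u, v} := by
      intro i
      obtain ⟨u, v, huv, h⟩ := Finset.card_eq_two.1 (P i).2
      rcases lt_or_gt_of_ne huv with h' | h'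
      · exact ⟨u, v, h', h⟩
      · exact ⟨v, u, h', by rw [h, Finset.pair_comm]⟩
    choose u v huv h using key
    refine ⟨(u, v), huv, s, fun x hx => hs x fun i => ?_⟩
    rw [h i]
    simpa using hx i

/-- If every earlier side is long enough for the pigeonhole principle, each coloring has
a monochromatic box. -/
lemma exists_monoOn {a : ℕ → ℕ} {c : ℕ} (d : ℕ)
    (ha : ∀ j < d, a j = 1 + c * ∏ i : Fin j, (a i).choose 2)
    (f : ((i : Fin d) → Fin (a i)) → Fin c) : ∃ P s, MonoOn f P s := by
  induction d with
  | zero => exact ⟨fun i => i.elim0, f fun i => i.elim0, fun x _ => congrArg f (funext fun i => i.elim0)⟩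
  | succ d ih =>
    have ih' := ih (fun j hj => ha j (by omega))
    choose P s hP using fun t : Fin (a d) => ih' fun x =>
      f (Fin.snoc (α := fun i : Fin (d + 1) => Fin (a i)) x t)
    obtain ⟨t, t', hne, heq⟩ := Fintype.exists_ne_map_eq_of_card_lt
      (fun t => ((P t, s t) : UBox a d × Fin c))
      (by rw [card_uBox_prod, Fintype.card_fin, ha d (by omega)]; omega)
    obtain ⟨hPt, hst⟩ := Prod.mk.inj heq
    refine ⟨Fin.snoc (α := fun i : Fin (d + 1) => {S : Finset (Fin (a i)) // S.card = 2})
      (P t) ⟨{t, t'}, Finset.card_pair hne⟩, s t, fun x hx => ?_⟩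
    have hinit : ∀ i : Fin d, x i.castSucc ∈ (P t i).1 := fun i => by
      simpa only [Fin.snoc_castSucc] using hx i.castSucc
    have hlast : x (Fin.last d) = t ∨ x (Fin.last d) = t' := by
      have := hx (Fin.last d)
      simp only [Fin.snoc_last] at this
      exact (Finset.mem_insert.1 this).imp id Finset.mem_singleton.1
    have hx' : Fin.snoc (α := fun i : Fin (d + 1) => Fin (a i)) (fun i => x i.castSucc)
        (x (Fin.last d)) = x := Fin.snoc_init_self x
    rw [← hx']
    rcases hlast with h | h
    · rw [h]
      exact hP t _ hinit
    · rw [h, hst]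
      exact hP t' _ (hPt ▸ hinit)

/-- A map onto a type with one element less may identify a prescribed pair, send it to a
prescribed value, and be injective otherwise. -/
lemma exists_map_identifying_pair {α β : Type*} [Fintype α] [Fintype β] [DecidableEq α]
    (h : Fintype.card α = 1 + Fintype.card β) {u v : α} (huv : u ≠ v) (b : β) :
    ∃ g : α → β, g u = b ∧ g v = b ∧
      ∀ x y, x ≠ y → g x = g y → ({x, y} : Finset α) = {u, v} := by
  classical
  have hcard : Fintype.card {x // x ≠ v} = Fintype.card β := by
    rw [Fintype.card_subtype_compl, Fintype.card_subtype_eq, h]; omega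
  let e₀ := Fintype.equivOfCardEq hcard
  let e := e₀.trans (Equiv.swap (e₀ ⟨u, huv⟩) b)
  have heu : e ⟨u, huv⟩ = b := by simp [e]
  refine ⟨fun x => if hx : x = v then b else e ⟨x, hx⟩, by simp [huv, heu], by simp, ?_⟩
  intro x y hxy hg
  by_cases hx : x = v <;> by_cases hy : y = v
  · exact absurd (hx.trans hy.symm) hxy
  · simp only [hx, hy, dite_true, dite_false] at hg
    have : u = y := congrArg Subtype.val (e.injective (heu.trans hg))
    rw [hx, ← this, Finset.pair_comm]
  · simp only [hx, hy, dite_true, dite_false] at hg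
    have : x = u := congrArg Subtype.val (e.injective (hg.trans heu.symm))
    rw [hy, this]
  · simp only [hx, hy, dite_false] at hg
    exact absurd (congrArg Subtype.val (e.injective hg)) hxy

/-- Each box, in each color, is the only monochromatic box of a suitable coloring. -/
lemma exists_unique_monoOn {a : ℕ → ℕ} {c : ℕ} (d : ℕ)
    (ha : ∀ j < d, a j = 1 + c * ∏ i : Fin j, (a i).choose 2) (q : UBox a d × Fin c) :
    ∃ f : ((i : Fin d) → Fin (a i)) → Fin c, MonoOn f q.1 q.2 ∧
      ∀ P s, MonoOn f P s → (P, s) = q := by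
  induction d with
  | zero =>
    refine ⟨fun _ => q.2, fun _ _ => rfl, fun P s h => Prod.ext (funext fun i => i.elim0) ?_⟩
    exact (h (fun i => i.elim0) fun i => i.elim0).symm
  | succ d ih =>
    choose F hF hF' using ih (fun j hj => ha j (by omega))
    obtain ⟨Q, t⟩ := q
    obtain ⟨u, v, huv, hQ⟩ := Finset.card_eq_two.1 (Q (Fin.last d)).2
    have hcard : Fintype.card (Fin (a (Fin.last d : Fin (d + 1)))) =
        1 + Fintype.card (UBox a d × Fin c) := by
      rw [card_uBox_prod, Fintype.card_fin]
      exact ha d (by omega)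
    obtain ⟨g, hgu, hgv, hg⟩ := exists_map_identifying_pair hcard huv
      ((fun i => Q i.castSucc, t) : UBox a d × Fin c)
    refine ⟨fun x => F (g (x (Fin.last d))) fun i => x i.castSucc, fun x hx => ?_, fun P s hP => ?_⟩
    · have hlast := hx (Fin.last d)
      simp only [hQ, Finset.mem_insert, Finset.mem_singleton] at hlast
      have hgx : g (x (Fin.last d)) = ((fun i => Q i.castSucc, t) : UBox a d × Fin c) := by
        rcases hlast with h | h <;> rw [h] <;> assumption
      simp only [hgx]
      exact hF ((fun i => Q i.castSucc, t) : UBox a d × Fin c) _ fun i => hx i.castSucc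
    · obtain ⟨x, y, hxy, hPl⟩ := Finset.card_eq_two.1 (P (Fin.last d)).2
      have slice : ∀ z ∈ (P (Fin.last d)).1,
          ((fun i => P i.castSucc, s) : UBox a d × Fin c) = g z := by
        refine fun z hz => hF' (g z) _ _ fun w hw => ?_
        have := hP (Fin.snoc (α := fun i : Fin (d + 1) => Fin (a i)) w z) fun i => by
          refine Fin.lastCases ?_ (fun i => ?_) i
          · simpa only [Fin.snoc_last] using hz
          · simpa only [Fin.snoc_castSucc] using hw i
        simpa only [Fin.snoc_last, Fin.snoc_castSucc] using this
      have hpair := hg x y hxy ((slice x (by simp [hPl])).symm.trans (slice y (by simp [hPl])))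
      have hPQ : P (Fin.last d) = Q (Fin.last d) := Subtype.ext (by rw [hPl, hQ, hpair])
      have hinit := (slice u (by simp [hPQ, hQ])).trans hgu
      obtain ⟨h1, h2⟩ := Prod.mk.inj hinit
      refine Prod.ext (funext fun i => ?_) h2
      exact Fin.lastCases hPQ (fun i => congrFun h1 i) i

/-- If side `k` is one shorter than the pigeonhole length determined by the earlier sides, some
coloring has no monochromatic box. -/
lemma exists_forall_not_monoOn {a : ℕ → ℕ} {c d : ℕ} (k : Fin d)
    (ha : ∀ j < (k : ℕ), a j = 1 + c * ∏ i : Fin j, (a i).choose 2)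
    (hk : a k = c * ∏ i : Fin k, (a i).choose 2) :
    ∃ f : ((i : Fin d) → Fin (a i)) → Fin c, ∀ P s, ¬ MonoOn f P s := by
  choose F hF hF' using exists_unique_monoOn (k : ℕ) ha
  have e : Fin (a k) ≃ UBox a k × Fin c :=
    Fintype.equivOfCardEq (by rw [card_uBox_prod, Fintype.card_fin, hk])
  refine ⟨fun x => F (e (x k)) fun i => x ⟨i, i.2.trans k.2⟩, fun P s hP => ?_⟩
  obtain ⟨x, y, hxy, hPk⟩ := Finset.card_eq_two.1 (P k).2
  have slice : ∀ z ∈ (P k).1,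
      ((fun i => P ⟨i, i.2.trans k.2⟩, s) : UBox a k × Fin c) = e z := by
    refine fun z hz => hF' (e z) _ _ fun w hw => ?_
    have hne : ∀ i, (P i).1.Nonempty := fun i => Finset.card_pos.1 (by rw [(P i).2]; norm_num)
    choose r hr using hne
    let w' : (i : Fin d) → Fin (a i) := fun i =>
      if h : (i : ℕ) < k then w ⟨i, h⟩ else r i
    have hw' : ∀ i, w' i ∈ (P i).1 := by
      intro i
      by_cases h : (i : ℕ) < k
      · simpa only [w', h, dite_true] using hw ⟨i, h⟩
      · simpa only [w', h, dite_false] using hr i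
    have := hP (Function.update w' k z) fun i => by
      by_cases h : i = k
      · subst h
        simpa using hz
      · simpa [h] using hw' i
    have hrestr : (fun i : Fin k => Function.update w' k z ⟨i, i.2.trans k.2⟩) = w := by
      funext i
      rw [Function.update_of_ne (Fin.ne_of_lt (Fin.lt_def.2 i.2))]
      exact dif_pos i.2
    simpa only [hrestr, Function.update_self] using this
  exact hxy (e.injective ((slice x (by simp [hPk])).symm.trans (slice y (by simp [hPk]))))

/-- `[μ_1(c),…,μ_d(c)]` lies in the obstruction set `O(c,d)`: it is
`c`-guaranteed, and decreasing any one side length by `1` yields a grid that is not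
`c`-guaranteed. -/
theorem mu_grid_in_obstruction_set (c : ℕ) (hc : 2 ≤ c) (μ : ℕ → ℕ) (hμ1 : μ 1 = 1 + c)
    (hμrec : ∀ j : ℕ, 1 ≤ j → μ (j + 1) = 1 + c * ∏ i ∈ Finset.Icc 1 j, (μ i).choose 2)
    (d : ℕ) (hd : 1 ≤ d) :
    Guaranteed d (fun i : Fin d => μ ((i : ℕ) + 1)) c 1 ∧
      ∀ k : Fin d,
        ¬ Guaranteed d
          (fun i : Fin d => if i = k then μ ((i : ℕ) + 1) - 1 else μ ((i : ℕ) + 1)) c 1 := by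
  have hμ : ∀ j, μ (j + 1) = 1 + c * ∏ i : Fin j, (μ (i + 1)).choose 2 := by
    intro j
    rw [Fin.prod_univ_eq_prod_range (fun i => (μ (i + 1)).choose 2) j]
    rcases Nat.eq_zero_or_pos j with rfl | hj
    · simpa using hμ1
    · rw [hμrec j hj, Finset.range_eq_Ico, Finset.prod_Ico_add' (fun i => (μ i).choose 2)]
      rfl
  refine ⟨(guaranteed_one_iff d (fun n => μ (n + 1)) c).2
    (exists_monoOn d fun j _ => hμ j), fun k => ?_⟩
  let a : ℕ → ℕ := fun n => if n = k then μ (n + 1) - 1 else μ (n + 1)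
  have hgrid : (fun i : Fin d => if i = k then μ ((i : ℕ) + 1) - 1 else μ ((i : ℕ) + 1)) =
      fun i : Fin d => a i := by
    funext i
    simp only [a, Fin.ext_iff]
  have ha : ∀ n < (k : ℕ), a n = μ (n + 1) := fun n hn => if_neg hn.ne
  have hprod : ∀ j ≤ (k : ℕ),
      ∏ i : Fin j, (a i).choose 2 = ∏ i : Fin j, (μ (i + 1)).choose 2 := fun j hj =>
    Finset.prod_congr rfl fun i _ => by rw [ha i (i.2.trans_le hj)]
  rw [hgrid, guaranteed_one_iff]
  obtain ⟨f, hf⟩ := exists_forall_not_monoOn (a := a) (c := c) k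
    (fun j hj => by rw [ha j hj, hprod j hj.le, hμ j])
    (by rw [hprod k le_rfl]; simp [a, hμ k])
  exact fun h => let ⟨P, s, hP⟩ := h f; hf P s hP
end

section
/- For every integer d ≥ 3 there exists a constant K (depending only on d) such that for all integers c ≥ 2, the obstruction set O(c,d) has cardinality at most K · c^{(17·3^{d−3}−1)/2}. -/
/-- The increasing pairs of elements of `Z`. -/
def ltPairs (Z : Finset ℕ) : Finset (ℕ × ℕ) := (Z ×ˢ Z).filter fun p => p.1 < p.2

lemma mem_ltPairs {Z : Finset ℕ} {p : ℕ × ℕ} :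
    p ∈ ltPairs Z ↔ (p.1 ∈ Z ∧ p.2 ∈ Z) ∧ p.1 < p.2 := by
  simp [ltPairs]

lemma two_mul_card_ltPairs_add_card (Z : Finset ℕ) :
    2 * (ltPairs Z).card + Z.card = Z.card ^ 2 := by
  have hswap : ((Z ×ˢ Z).filter fun p => p.2 < p.1).card = (ltPairs Z).card := by
    refine Finset.card_bij' (fun p _ => p.swap) (fun p _ => p.swap) ?_ ?_ ?_ ?_ <;>
      simp +contextual [ltPairs]
  have hdiag : ((Z ×ˢ Z).filter fun p => p.1 = p.2).card = Z.card := by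
    refine Finset.card_bij' (fun p _ => p.1) (fun z _ => (z, z)) ?_ ?_ ?_ ?_ <;>
      simp +contextual
  have h1 := Finset.card_filter_add_card_filter_not (s := Z ×ˢ Z) (fun p => p.1 < p.2)
  have h2 := Finset.card_filter_add_card_filter_not
    (s := (Z ×ˢ Z).filter fun p => ¬ p.1 < p.2) (fun p => p.1 = p.2)
  rw [Finset.filter_filter, Finset.filter_filter] at h2
  have e1 : ((Z ×ˢ Z).filter fun p => ¬ p.1 < p.2 ∧ p.1 = p.2)
      = (Z ×ˢ Z).filter fun p => p.1 = p.2 :=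
    Finset.filter_congr fun p _ => by omega
  have e2 : ((Z ×ˢ Z).filter fun p => ¬ p.1 < p.2 ∧ ¬ p.1 = p.2)
      = (Z ×ˢ Z).filter fun p => p.2 < p.1 :=
    Finset.filter_congr fun p _ => by omega
  rw [e1, e2, hdiag, hswap] at h2
  rw [Finset.card_product] at h1
  unfold ltPairs at *
  nlinarith

/-- The boxes of the grid with side lengths `a`, given by their pairs of extreme coordinates. -/
def boxes {k : ℕ} (a : Fin k → ℕ) : Finset (Fin k → ℕ × ℕ) :=
  Fintype.piFinset fun i => ltPairs (Finset.range (a i))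

/-- The box `B` is constantly coloured `s` by `F`. -/
def MonoIn {k c : ℕ} (F : (Fin k → ℕ) → Fin c) (B : Fin k → ℕ × ℕ) (s : Fin c) : Prop :=
  ∀ x : Fin k → ℕ, (∀ i, x i = (B i).1 ∨ x i = (B i).2) → F x = s

open Classical in
/-- The monochromatic boxes of the grid `a` under the colouring `F`. -/
noncomputable def monoBoxes {k c : ℕ} (F : (Fin k → ℕ) → Fin c) (a : Fin k → ℕ) :
    Finset (Fin k → ℕ × ℕ) := (boxes a).filter fun B => ∃ s, MonoIn F B s

/-- Every `c`-colouring makes at least a fraction `2c / M` of the boxes of `a` monochromatic. -/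
def IsDense (c : ℕ) {k : ℕ} (a : Fin k → ℕ) (M : ℕ) : Prop :=
  ∀ F : (Fin k → ℕ) → Fin c, 2 * c * (boxes a).card ≤ M * (monoBoxes F a).card

/-- Every `c`-colouring of `ℕ^k` has a monochromatic box inside the grid `a`. -/
def ForcesBox (c : ℕ) {k : ℕ} (a : Fin k → ℕ) : Prop :=
  ∀ F : (Fin k → ℕ) → Fin c, (monoBoxes F a).Nonempty

lemma mem_monoBoxes {k c : ℕ} {F : (Fin k → ℕ) → Fin c} {a : Fin k → ℕ} {B : Fin k → ℕ × ℕ} :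
    B ∈ monoBoxes F a ↔ B ∈ boxes a ∧ ∃ s, MonoIn F B s := by
  simp [monoBoxes]

lemma mem_boxes {k : ℕ} {a : Fin k → ℕ} {B : Fin k → ℕ × ℕ} :
    B ∈ boxes a ↔ ∀ i, (B i).1 < (B i).2 ∧ (B i).2 < a i := by
  simp only [boxes, Fintype.mem_piFinset, mem_ltPairs, Finset.mem_range]
  exact forall_congr' fun i => by omega

lemma card_boxes {k : ℕ} (a : Fin k → ℕ) :
    (boxes a).card = ∏ i, (ltPairs (Finset.range (a i))).card := Fintype.card_piFinset _

lemma card_boxes_le {k : ℕ} (a : Fin k → ℕ) : (boxes a).card ≤ ∏ i, a i ^ 2 := by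
  rw [card_boxes]
  refine Finset.prod_le_prod' fun i _ => ?_
  have := two_mul_card_ltPairs_add_card (Finset.range (a i))
  rw [Finset.card_range] at this
  omega

lemma boxes_nonempty {k : ℕ} {a : Fin k → ℕ} (ha : ∀ i, 2 ≤ a i) : (boxes a).Nonempty :=
  ⟨fun _ => (0, 1), mem_boxes.2 fun i => ⟨Nat.zero_lt_one, ha i⟩⟩

lemma MonoIn.unique {k c : ℕ} {F : (Fin k → ℕ) → Fin c} {B : Fin k → ℕ × ℕ} {s t : Fin c}
    (hs : MonoIn F B s) (ht : MonoIn F B t) : s = t := by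
  rw [← hs (fun i => (B i).1) fun i => Or.inl rfl, ht (fun i => (B i).1) fun i => Or.inl rfl]

lemma MonoIn.snoc {k c : ℕ} {F : (Fin (k + 1) → ℕ) → Fin c} {B : Fin k → ℕ × ℕ} {s : Fin c}
    {z : ℕ × ℕ} (h1 : MonoIn (fun x => F (Fin.snoc x z.1)) B s)
    (h2 : MonoIn (fun x => F (Fin.snoc x z.2)) B s) :
    MonoIn F (Fin.snoc B z : Fin (k + 1) → ℕ × ℕ) s := by
  intro x hx
  rw [Fin.forall_fin_succ'] at hx
  simp only [Fin.snoc_castSucc, Fin.snoc_last] at hx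
  have hF : F x = F (Fin.snoc (fun i : Fin k => x i.castSucc) (x (Fin.last k))) := by
    congr 1
    exact (Fin.snoc_init_self x).symm
  rw [hF]
  rcases hx.2 with h | h
  · rw [h]; exact h1 _ hx.1
  · rw [h]; exact h2 _ hx.1

lemma IsDense.mono {c k M M' : ℕ} {a : Fin k → ℕ} (h : IsDense c a M) (hM : M ≤ M') :
    IsDense c a M' :=
  fun F => (h F).trans (Nat.mul_le_mul_right _ hM)

lemma isDense_fin_zero {c : ℕ} (a : Fin 0 → ℕ) : IsDense c a (2 * c) := by
  intro F
  have : monoBoxes F a = boxes a := by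
    ext B
    rw [mem_monoBoxes, and_iff_left]
    exact ⟨F default, fun x _ => by rw [Subsingleton.elim x default]⟩
  rw [this]

lemma ForcesBox.isDense {c k : ℕ} {a : Fin k → ℕ} (h : ForcesBox c a) :
    IsDense c a (2 * c * ∏ i, a i ^ 2) := fun F =>
  (Nat.mul_le_mul_left _ (card_boxes_le a)).trans
    (Nat.le_mul_of_pos_right _ (Finset.card_pos.2 (h F)))

lemma IsDense.forcesBox {c k M : ℕ} {a : Fin k → ℕ} (hc : 0 < c) (ha : ∀ i, 2 ≤ a i)
    (h : IsDense c a M) : ForcesBox c a := by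
  intro F
  have h1 := h F
  have h2 := Finset.card_pos.2 (boxes_nonempty ha)
  rw [← Finset.card_pos]
  by_contra h0
  rw [Nat.eq_zero_of_not_pos h0, mul_zero] at h1
  have : 0 < 2 * c * (boxes a).card := by positivity
  omega

lemma density_arith {W M n Y Q S P : ℕ} (hY : 2 * W * n ≤ M * Y) (hn : M ≤ n)
    (hQ : Y ^ 2 ≤ W * Q) (hS : Q ≤ 2 * S + Y) (hP : 2 * P ≤ n ^ 2) :
    2 * W * P ≤ M ^ 2 * S := by
  rcases Nat.eq_zero_or_pos W with rfl | hW
  · simp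
  rcases Nat.eq_zero_or_pos M with rfl | hM
  · have : n = 0 := by
      by_contra h
      have : 0 < 2 * W * n := by positivity
      omega
    subst this
    have : P = 0 := by omega
    simp [this]
  have hYW : 2 * W ≤ Y := by
    refine Nat.le_of_mul_le_mul_left ?_ hM
    calc M * (2 * W) = 2 * W * M := by ring
      _ ≤ 2 * W * n := Nat.mul_le_mul_left _ hn
      _ ≤ M * Y := hY
  have h4 : Y ^ 2 ≤ 4 * W * S := by
    have : Y ^ 2 ≤ W * (2 * S + Y) := hQ.trans (Nat.mul_le_mul_left _ hS)
    nlinarith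
  have h5 : 4 * W * (W * n ^ 2) ≤ 4 * W * (M ^ 2 * S) := by
    calc 4 * W * (W * n ^ 2) = (2 * W * n) ^ 2 := by ring
      _ ≤ (M * Y) ^ 2 := Nat.pow_le_pow_left hY 2
      _ = M ^ 2 * Y ^ 2 := by ring
      _ ≤ M ^ 2 * (4 * W * S) := Nat.mul_le_mul_left _ h4
      _ = 4 * W * (M ^ 2 * S) := by ring
  have h6 := Nat.le_of_mul_le_mul_left h5 (by positivity)
  calc 2 * W * P = W * (2 * P) := by ring
    _ ≤ W * n ^ 2 := Nat.mul_le_mul_left _ hP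
    _ ≤ _ := h6

open Classical in
/-- Appending a side of length at least `M` squares the density parameter. -/
lemma IsDense.snoc {c k M : ℕ} {a : Fin (k + 1) → ℕ}
    (h : IsDense c (fun i : Fin k => a i.castSucc) M) (hM : M ≤ a (Fin.last k)) :
    IsDense c a (M ^ 2) := by
  intro F
  set a' : Fin k → ℕ := fun i => a i.castSucc with ha'
  set n := a (Fin.last k) with hn
  let L : ℕ → (Fin k → ℕ) → Fin c := fun z x => F (Fin.snoc x z)
  let Z : (Fin k → ℕ × ℕ) × Fin c → Finset ℕ := fun p =>
    (Finset.range n).filter fun z => MonoIn (L z) p.1 p.2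
  let I : Finset ((Fin k → ℕ × ℕ) × Fin c) := boxes a' ×ˢ Finset.univ
  have hI : I.card = c * (boxes a').card := by simp [I, mul_comm]
  have hcard : (boxes a).card = (boxes a').card * (ltPairs (Finset.range n)).card := by
    rw [card_boxes, card_boxes, Fin.prod_univ_castSucc]
  have hP : 2 * (ltPairs (Finset.range n)).card ≤ n ^ 2 := by
    have := two_mul_card_ltPairs_add_card (Finset.range n)
    rw [Finset.card_range] at this
    omega
  have hQ : (∑ p ∈ I, (Z p).card) ^ 2 ≤ I.card * ∑ p ∈ I, (Z p).card ^ 2 :=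
    sq_sum_le_card_mul_sum_sq
  have hY : 2 * I.card * n ≤ M * ∑ p ∈ I, (Z p).card := by
    have hlayer : ∀ z, (monoBoxes (L z) a').card
        ≤ (I.filter fun p => MonoIn (L z) p.1 p.2).card := by
      intro z
      have : monoBoxes (L z) a'
          ⊆ (I.filter fun p => MonoIn (L z) p.1 p.2).image Prod.fst := by
        intro B hB
        obtain ⟨hB, s, hs⟩ := mem_monoBoxes.1 hB
        exact Finset.mem_image.2 ⟨(B, s), by simp [I, hB, hs], rfl⟩
      exact (Finset.card_le_card this).trans Finset.card_image_le
    have hsum : ∑ p ∈ I, (Z p).card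
        = ∑ z ∈ Finset.range n, (I.filter fun p => MonoIn (L z) p.1 p.2).card := by
      simp only [Z, Finset.card_filter]
      exact Finset.sum_comm
    rw [hsum, Finset.mul_sum, hI]
    calc 2 * (c * (boxes a').card) * n
        = ∑ z ∈ Finset.range n, 2 * c * (boxes a').card := by
          rw [Finset.sum_const, Finset.card_range, smul_eq_mul]; ring
      _ ≤ _ := Finset.sum_le_sum fun z _ =>
          (h (L z)).trans (Nat.mul_le_mul_left _ (hlayer z))
  have hS : ∑ p ∈ I, (Z p).card ^ 2
      ≤ 2 * (monoBoxes F a).card + ∑ p ∈ I, (Z p).card := by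
    have hpairs : ∑ p ∈ I, (ltPairs (Z p)).card ≤ (monoBoxes F a).card := by
      rw [← Finset.card_sigma]
      refine Finset.card_le_card_of_injOn
        (fun q => (Fin.snoc q.1.1 q.2 : Fin (k + 1) → ℕ × ℕ)) ?_ ?_
      · rintro ⟨⟨B, s⟩, z⟩ hq
        simp only [Finset.coe_sigma, Set.mem_sigma_iff, Finset.mem_coe, I, Z, mem_ltPairs,
          Finset.mem_product, Finset.mem_filter, Finset.mem_range] at hq
        obtain ⟨⟨hB, -⟩, ⟨⟨h1, m1⟩, h2, m2⟩, hlt⟩ := hq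
        refine mem_monoBoxes.2 ⟨mem_boxes.2 ?_, s, m1.snoc m2⟩
        rw [Fin.forall_fin_succ']
        simp only [Fin.snoc_castSucc, Fin.snoc_last]
        exact ⟨mem_boxes.1 hB, hlt, h2⟩
      · rintro ⟨⟨B, s⟩, z⟩ hq ⟨⟨B', s'⟩, z'⟩ hq' heq
        simp only [Finset.coe_sigma, Set.mem_sigma_iff, Finset.mem_coe, I, Z, mem_ltPairs,
          Finset.mem_product, Finset.mem_filter, Finset.mem_range] at hq hq'
        obtain ⟨rfl, rfl⟩ := Fin.snoc_inj.1 heq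
        obtain rfl := hq.2.1.1.2.unique hq'.2.1.1.2
        rfl
    calc ∑ p ∈ I, (Z p).card ^ 2
        = ∑ p ∈ I, (2 * (ltPairs (Z p)).card + (Z p).card) :=
          Finset.sum_congr rfl fun p _ => (two_mul_card_ltPairs_add_card _).symm
      _ = 2 * ∑ p ∈ I, (ltPairs (Z p)).card + ∑ p ∈ I, (Z p).card := by
          rw [Finset.sum_add_distrib, Finset.mul_sum]
      _ ≤ _ := by omega
  have := density_arith hY hM hQ hS hP
  rw [hI] at this
  rw [hcard]
  linarith

lemma ForcesBox.restrict {c k m : ℕ} {a : Fin m → ℕ} (h : ForcesBox c a) (hkm : k ≤ m) :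
    ForcesBox c fun i : Fin k => a (Fin.castLE hkm i) := by
  intro F
  obtain ⟨B, hB⟩ := h fun x => F fun i => x (Fin.castLE hkm i)
  obtain ⟨hB, s, hs⟩ := mem_monoBoxes.1 hB
  refine ⟨fun i => B (Fin.castLE hkm i),
    mem_monoBoxes.2 ⟨mem_boxes.2 fun i => mem_boxes.1 hB _, s, fun x hx => ?_⟩⟩
  have := hs (fun j => if hj : (j : ℕ) < k then x ⟨j, hj⟩ else (B j).1) fun j => by
    by_cases hj : (j : ℕ) < k
    · simpa [hj] using hx ⟨j, hj⟩
    · simp [hj]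
  simpa using this

lemma exists_exponent_extension {C h m e : ℕ} {a r : ℕ → ℕ} (hr : ∀ j < h, a j ≤ C ^ r j)
    (he : ∀ j < h + m, a j ≤ C ^ e) :
    ∃ r' : ℕ → ℕ, ∑ j ∈ Finset.range (h + m), r' j = ∑ j ∈ Finset.range h, r j + m * e ∧
      ∀ j < h + m, a j ≤ C ^ r' j := by
  refine ⟨fun j => if j < h then r j else e, ?_, fun j hj => ?_⟩
  · rw [Finset.sum_range_add]
    congr 1
    · exact Finset.sum_congr rfl fun j hj => if_pos (Finset.mem_range.1 hj)
    · simp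
  · dsimp only
    split_ifs with hjh
    exacts [hr j hjh, he j hj]

lemma two_mul_succ_mul_two_pow_le (m : ℕ) : 1 + 2 * ((m + 1) * 2 ^ m) ≤ 3 ^ (m + 1) := by
  induction m with
  | zero => norm_num
  | succ m ih =>
    rcases m with _ | m
    · norm_num
    rw [pow_succ 3 (m + 2), pow_succ 2 (m + 1)]
    nlinarith [Nat.zero_le (m * 2 ^ (m + 1))]

lemma nine_mul_le_seventeen_mul_three_pow (m : ℕ) :
    9 * (1 + 2 * (m * 2 ^ m)) ≤ 17 * 3 ^ m := by
  obtain hm | hm := lt_or_ge m 2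
  · interval_cases m <;> norm_num
  induction m, hm using Nat.le_induction with
  | base => norm_num
  | succ m hm ih =>
    rw [pow_succ, pow_succ]
    have : 2 * 2 ^ m ≤ m * 2 ^ m := Nat.mul_le_mul_right _ hm
    nlinarith

/-- The side lengths of a sorted minimal grid, all but the largest, are bounded by powers of `2c`
with controlled total exponent. -/
lemma exists_exponents_of_minimal {n c : ℕ} (hc : 0 < c) {a : ℕ → ℕ}
    (hmono : ∀ i j, i ≤ j → j < n + 3 → a i ≤ a j) (h2 : ∀ i < n + 3, 2 ≤ a i)
    (hG : ForcesBox c fun i : Fin (n + 3) => a i)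
    (hmin : ∀ T, 1 ≤ T → T < a (n + 1) →
      ¬ ForcesBox c fun i : Fin (n + 3) => Function.update a (n + 1) T i) :
    ∃ r : ℕ → ℕ, 2 * ∑ j ∈ Finset.range (n + 2), r j + 1 ≤ 17 * 3 ^ n ∧
      ∀ j < n + 2, a j ≤ (2 * c) ^ r j := by
  classical
  set C := 2 * c with hC
  have hC2 : 2 ≤ C := by omega
  let P : ℕ → Prop := fun k => ∃ r : ℕ → ℕ, 2 * ∑ j ∈ Finset.range k, r j + 1 ≤ 3 ^ k ∧
    ∀ j < k, a j ≤ C ^ r j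
  have hP0 : P 0 := ⟨0, by simp, by simp⟩
  set h := Nat.findGreatest P (n + 2)
  have hhn : h ≤ n + 2 := Nat.findGreatest_le _
  obtain ⟨r, hr1, hr2⟩ : P h := Nat.findGreatest_spec (Nat.zero_le _) hP0
  have hlarge : ∀ m, h + m < n + 2 → C ^ (2 ^ m * 3 ^ h) < a (h + m) := by
    intro m hm
    by_contra! hle
    obtain ⟨r', hs, hr'⟩ := exists_exponent_extension (m := m + 1) (e := 2 ^ m * 3 ^ h) hr2
      fun j hj => (hmono j (h + m) (by omega) (by omega)).trans hle
    have hP : P (h + (m + 1)) := by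
      refine ⟨r', ?_, hr'⟩
      have := Nat.mul_le_mul_left (3 ^ h) (two_mul_succ_mul_two_pow_le m)
      rw [hs, pow_add]
      nlinarith
    have := Nat.le_findGreatest (n := n + 2) (by omega) hP
    omega
  have hdense : ∀ m, h + m < n + 2 →
      IsDense c (fun i : Fin (h + m) => a i) (C ^ (2 ^ m * 3 ^ h)) := by
    intro m
    induction m with
    | zero =>
      intro _
      have hF : ForcesBox c fun i : Fin h => a i := hG.restrict (by omega : h ≤ n + 3)
      refine hF.isDense.mono ?_
      rw [← Finset.prod_range fun i => a i ^ 2]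
      calc C * ∏ j ∈ Finset.range h, a j ^ 2
          ≤ C * ∏ j ∈ Finset.range h, (C ^ r j) ^ 2 :=
            Nat.mul_le_mul_left _ (Finset.prod_le_prod' fun j hj =>
              Nat.pow_le_pow_left (hr2 j (Finset.mem_range.1 hj)) 2)
        _ = C ^ (2 * ∑ j ∈ Finset.range h, r j + 1) := by
            rw [Finset.prod_pow, Finset.prod_pow_eq_pow_sum]; ring
        _ ≤ C ^ (2 ^ 0 * 3 ^ h) := Nat.pow_le_pow_right (by omega) (by simpa using hr1)
    | succ m ih =>
      intro hm
      have := IsDense.snoc (a := fun i : Fin (h + m + 1) => a i) (ih (by omega))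
        (hlarge m (by omega)).le
      rw [← pow_mul] at this
      rwa [pow_succ, mul_right_comm]
  obtain ⟨m, hm⟩ : ∃ m, n + 2 = h + m := ⟨n + 2 - h, by omega⟩
  have htop : ∀ j < h + m, 0 < m → a j ≤ C ^ (2 ^ m * 3 ^ h) := by
    intro j hj hm0
    obtain ⟨l, rfl⟩ : ∃ l, m = l + 1 := ⟨m - 1, by omega⟩
    obtain hn : n + 1 = h + l := by omega
    refine (hmono j (n + 1) (by omega) (by omega)).trans ?_
    by_contra! hlt
    set M := C ^ (2 ^ l * 3 ^ h) with hM
    have hMM : C ^ (2 ^ (l + 1) * 3 ^ h) = M ^ 2 := by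
      rw [hM, ← pow_mul, pow_succ, mul_right_comm]
    rw [hMM] at hlt
    have hM2 : 2 ≤ M := hC2.trans (Nat.le_self_pow (by positivity) _)
    have hMsq : M ≤ M ^ 2 := Nat.le_self_pow (by norm_num) _
    refine hmin (M ^ 2) (by omega) hlt ?_
    set b := Function.update a (n + 1) (M ^ 2) with hb
    have hbne : ∀ i, i ≠ n + 1 → b i = a i := fun i hi => Function.update_of_ne hi _ _
    have hbn : b (n + 1) = M ^ 2 := Function.update_self _ _ _
    have d1 : IsDense c (fun i : Fin (n + 1) => b i) M := by
      have e : (fun i : Fin (n + 1) => b i) = fun i : Fin (n + 1) => a i :=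
        funext fun i => hbne i i.2.ne
      rw [e, hn]
      exact hdense l (by omega)
    have d2 : IsDense c (fun i : Fin (n + 2) => b i) (M ^ 2) :=
      IsDense.snoc (a := fun i : Fin (n + 2) => b i) d1 (by simpa [hbn] using hMsq)
    have d3 : IsDense c (fun i : Fin (n + 3) => b i) ((M ^ 2) ^ 2) := by
      refine IsDense.snoc (a := fun i : Fin (n + 3) => b i) d2 ?_
      simp only [Fin.val_last]
      rw [hbne (n + 2) (by omega)]
      exact hlt.le.trans (hmono _ _ (by omega) (by omega))
    refine d3.forcesBox hc fun i => ?_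
    obtain hi | hi := eq_or_ne (i : ℕ) (n + 1)
    · rw [hi, hbn]; omega
    · rw [hbne i hi]; exact h2 i i.2
  have hfin : ∃ r' : ℕ → ℕ, ∑ j ∈ Finset.range (h + m), r' j
      = ∑ j ∈ Finset.range h, r j + m * (2 ^ m * 3 ^ h) ∧ ∀ j < h + m, a j ≤ C ^ r' j := by
    rcases Nat.eq_zero_or_pos m with rfl | hm0
    · exact ⟨r, by simp, hr2⟩
    · exact exists_exponent_extension hr2 fun j hj => htop j hj hm0
  obtain ⟨r', hs, hr'⟩ := hfin
  refine ⟨r', ?_, hm ▸ hr'⟩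
  have h9 : 9 * 3 ^ n = 3 ^ h * 3 ^ m := by
    rw [← pow_add, ← hm, pow_add]; ring
  have := Nat.mul_le_mul_left (3 ^ h) (nine_mul_le_seventeen_mul_three_pow m)
  rw [hm, hs]
  nlinarith

lemma guaranteed_one_iff_s16 {d c : ℕ} (hc : 0 < c) (a : Fin d → ℕ) :
    Guaranteed d a c 1 ↔ ForcesBox c a := by
  have hfin : Finite (GridPoint d a) := inferInstanceAs (Finite ((i : Fin d) → Fin (a i)))
  have hne : ∀ f : GridPoint d a → Fin c, 1 ≤ (monoBoxSet f).ncard ↔ (monoBoxSet f).Nonempty :=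
    fun f => by rw [Nat.one_le_iff_ne_zero, ← Nat.pos_iff_ne_zero, Set.ncard_pos (Set.toFinite _)]
  constructor
  · intro h F
    obtain ⟨p, hp, s, hs⟩ := (hne _).1 (h fun x => F fun i => x i)
    refine ⟨fun i => (p.1 i, p.2 i), mem_monoBoxes.2
      ⟨mem_boxes.2 fun i => ⟨hp i, (p.2 i).2⟩, s, fun x hx => ?_⟩⟩
    have hlt : ∀ i, x i < a i := fun i => by
      rcases hx i with h | h <;> rw [h]
      exacts [(p.1 i).2, (p.2 i).2]
    exact hs (fun i => ⟨x i, hlt i⟩) fun i => by simpa [Fin.ext_iff] using hx i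
  · intro h f
    classical
    rw [hne]
    obtain ⟨B, hB⟩ := h fun x => if hx : ∀ i, x i < a i then f fun i => ⟨x i, hx i⟩ else ⟨0, hc⟩
    obtain ⟨hB, s, hs⟩ := mem_monoBoxes.1 hB
    rw [mem_boxes] at hB
    refine ⟨(fun i => ⟨(B i).1, (hB i).1.trans (hB i).2⟩, fun i => ⟨(B i).2, (hB i).2⟩),
      fun i => (hB i).1, s, fun x hx => ?_⟩
    have := hs (fun i => x i) fun i => by simpa [Fin.ext_iff] using hx i
    exact (dif_pos fun i => (x i).2).symm.trans this

lemma ForcesBox.comp_perm {d c : ℕ} {a : Fin d → ℕ} (h : ForcesBox c a)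
    (σ : Equiv.Perm (Fin d)) : ForcesBox c (a ∘ σ) := by
  intro F
  obtain ⟨B, hB⟩ := h fun x => F (x ∘ σ)
  obtain ⟨hB, s, hs⟩ := mem_monoBoxes.1 hB
  refine ⟨B ∘ σ, mem_monoBoxes.2 ⟨mem_boxes.2 fun i => mem_boxes.1 hB _, s, fun x hx => ?_⟩⟩
  have := hs (x ∘ σ.symm) fun i => by simpa using hx (σ.symm i)
  simpa [Function.comp_assoc] using this

lemma InObstructionSet.comp_perm {d c : ℕ} (hc : 0 < c) {a : Fin d → ℕ}
    (h : InObstructionSet d c a) (σ : Equiv.Perm (Fin d)) : InObstructionSet d c (a ∘ σ) := by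
  refine ⟨(guaranteed_one_iff_s16 hc _).2 (((guaranteed_one_iff_s16 hc _).1 h.1).comp_perm σ),
    fun b hb hba hne hG => h.2 (b ∘ σ.symm) (fun i => hb _)
      (fun i => by simpa using hba (σ.symm i)) ?_
      ((guaranteed_one_iff_s16 hc _).2 (((guaranteed_one_iff_s16 hc _).1 hG).comp_perm σ.symm))⟩
  rintro rfl
  exact hne (by ext i; simp)

lemma InObstructionSet.eq_of_le {d c : ℕ} {a b : Fin d → ℕ} (ha : InObstructionSet d c a)
    (hb : InObstructionSet d c b) (h1 : ∀ i, 1 ≤ a i) (hab : a ≤ b) : a = b := by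
  by_contra hne
  exact hb.2 a h1 hab hne ha.1

lemma InObstructionSet.two_le {d c : ℕ} (hc : 0 < c) {a : Fin d → ℕ}
    (h : InObstructionSet d c a) (i : Fin d) : 2 ≤ a i := by
  obtain ⟨B, hB⟩ := (guaranteed_one_iff_s16 hc _).1 h.1 fun _ => ⟨0, hc⟩
  have := mem_boxes.1 (mem_monoBoxes.1 hB).1 i
  omega

/-- The sorted grids in the obstruction set. -/
def sortedObstructions (d c : ℕ) : Set (Fin d → ℕ) :=
  {a | Monotone a ∧ InObstructionSet d c a}

lemma sortedObstructions_exponents {n c : ℕ} (hc : 0 < c) {a : Fin (n + 3) → ℕ}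
    (ha : a ∈ sortedObstructions (n + 3) c) :
    ∃ r : Fin (n + 2) → ℕ, ∑ j, r j ≤ (17 * 3 ^ n - 1) / 2 ∧
      ∀ j : Fin (n + 2), a j.castSucc ≤ (2 * c) ^ r j := by
  obtain ⟨hmono, hO⟩ := ha
  let a' : ℕ → ℕ := fun i => if hi : i < n + 3 then a ⟨i, hi⟩ else 0
  have ha' : ∀ i : Fin (n + 3), a' i = a i := fun i => dif_pos i.2
  have hval : ∀ i (hi : i < n + 3), a' i = a ⟨i, hi⟩ := fun i hi => dif_pos hi
  obtain ⟨r, hr1, hr2⟩ := exists_exponents_of_minimal (n := n) hc (a := a')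
    (fun i j hij hj => by
      rw [hval i (by omega), hval j hj]; exact hmono hij)
    (fun i hi => by rw [hval i hi]; exact hO.two_le hc _)
    (by simpa only [ha'] using (guaranteed_one_iff_s16 hc _).1 hO.1)
    (fun T hT hlt hF => by
      refine hO.2 _ ?_ ?_ ?_ ((guaranteed_one_iff_s16 hc _).2 hF)
      · intro i
        rw [Function.update_apply]
        split_ifs
        · exact hT
        · rw [ha']; exact le_trans (by norm_num) (hO.two_le hc i)
      · intro i
        rw [Function.update_apply]
        split_ifs with hi
        · rw [← ha', hi]; exact hlt.le
        · rw [ha']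
      · intro heq
        have := congrFun heq ⟨n + 1, by omega⟩
        rw [← ha'] at this
        simp only [Function.update_self] at this
        omega)
  refine ⟨fun j => r j, ?_, fun j => ?_⟩
  · rw [← Finset.sum_range]
    omega
  · rw [← ha']
    exact hr2 j j.2

lemma sortedObstructions_finite_and_ncard_le {n c : ℕ} (hc : 0 < c) :
    (sortedObstructions (n + 3) c).Finite ∧ (sortedObstructions (n + 3) c).ncard ≤
      ((17 * 3 ^ n - 1) / 2 + 1) ^ (n + 2) * (2 * c) ^ ((17 * 3 ^ n - 1) / 2) := by
  classical
  set e := (17 * 3 ^ n - 1) / 2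
  let R : Finset (Fin (n + 2) → ℕ) :=
    (Fintype.piFinset fun _ => Finset.range (e + 1)).filter fun r => ∑ j, r j ≤ e
  let U : Finset (Fin (n + 2) → ℕ) :=
    R.biUnion fun r => Fintype.piFinset fun j => Finset.Icc 1 ((2 * c) ^ r j)
  have hU : U.card ≤ (e + 1) ^ (n + 2) * (2 * c) ^ e := by
    have hR : R.card ≤ (e + 1) ^ (n + 2) :=
      (Finset.card_filter_le _ _).trans (by simp)
    refine (Finset.card_biUnion_le_card_mul _ _ ((2 * c) ^ e) fun r hr => ?_).trans
      (Nat.mul_le_mul_right _ hR)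
    rw [Fintype.card_piFinset]
    simp only [Nat.card_Icc, Nat.add_sub_cancel]
    rw [Finset.prod_pow_eq_pow_sum]
    exact Nat.pow_le_pow_right (by omega) (Finset.mem_filter.1 hr).2
  have hmaps : Set.MapsTo (fun (a : Fin (n + 3) → ℕ) (j : Fin (n + 2)) => a j.castSucc)
      (sortedObstructions (n + 3) c) U := by
    intro a ha
    obtain ⟨r, hr1, hr2⟩ := sortedObstructions_exponents hc ha
    refine Finset.mem_biUnion.2 ⟨r, Finset.mem_filter.2 ⟨Fintype.mem_piFinset.2 fun j => ?_, hr1⟩,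
      Fintype.mem_piFinset.2 fun j => Finset.mem_Icc.2 ⟨?_, hr2 j⟩⟩
    · have := Finset.single_le_sum (f := r) (fun i _ => Nat.zero_le _) (Finset.mem_univ j)
      exact Finset.mem_range.2 (by omega)
    · exact le_trans (by norm_num) (ha.2.two_le hc _)
  have hinj : Set.InjOn (fun (a : Fin (n + 3) → ℕ) (j : Fin (n + 2)) => a j.castSucc)
      (sortedObstructions (n + 3) c) := by
    have key : ∀ a ∈ sortedObstructions (n + 3) c, ∀ b ∈ sortedObstructions (n + 3) c,
        (∀ j : Fin (n + 2), a j.castSucc = b j.castSucc) →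
        a (Fin.last _) ≤ b (Fin.last _) → a = b := by
      intro a ha b hb hab hlast
      refine ha.2.eq_of_le hb.2 (fun i => le_trans (by norm_num) (ha.2.two_le hc i)) ?_
      rw [Pi.le_def, Fin.forall_fin_succ']
      exact ⟨fun j => (hab j).le, hlast⟩
    intro a ha b hb hab
    have hab := congrFun hab
    rcases le_total (a (Fin.last _)) (b (Fin.last _)) with hl | hl
    · exact key a ha b hb hab hl
    · exact (key b hb a ha (fun j => (hab j).symm) hl).symm
  refine ⟨Set.Finite.of_injOn hmaps hinj U.finite_toSet, ?_⟩
  have := Set.ncard_le_ncard_of_injOn _ hmaps hinj U.finite_toSet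
  rw [Set.ncard_coe_finset] at this
  exact this.trans hU

/-- for fixed `d ≥ 3`, `|O(c,d)| = O(c^((17·3^(d-3) - 1)/2))`. -/
theorem obstruction_set_size_bound (d : ℕ) (hd : 3 ≤ d) :
    ∃ K : ℕ, ∀ c : ℕ, 2 ≤ c →
      {a : Fin d → ℕ | (∀ i, 1 ≤ a i) ∧ InObstructionSet d c a}.ncard
        ≤ K * c ^ ((17 * 3 ^ (d - 3) - 1) / 2) := by
  obtain ⟨n, rfl⟩ : ∃ n, d = n + 3 := ⟨d - 3, by omega⟩
  rw [Nat.add_sub_cancel]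
  set e := (17 * 3 ^ n - 1) / 2 with he
  refine ⟨(n + 3).factorial * ((e + 1) ^ (n + 2) * 2 ^ e), fun c hc2 => ?_⟩
  have hc : 0 < c := by omega
  obtain ⟨hfin, hcard⟩ := sortedObstructions_finite_and_ncard_le (n := n) hc
  have hsub : {a : Fin (n + 3) → ℕ | (∀ i, 1 ≤ a i) ∧ InObstructionSet (n + 3) c a}
      ⊆ ⋃ σ : Equiv.Perm (Fin (n + 3)), (fun a => a ∘ σ) '' sortedObstructions (n + 3) c := by
    rintro a ⟨-, ha⟩
    refine Set.mem_iUnion.2 ⟨(Tuple.sort a).symm, a ∘ Tuple.sort a,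
      ⟨Tuple.monotone_sort a, ha.comp_perm hc _⟩, ?_⟩
    ext i
    simp
  calc _ ≤ (⋃ σ : Equiv.Perm (Fin (n + 3)),
        (fun a => a ∘ σ) '' sortedObstructions (n + 3) c).ncard :=
        Set.ncard_le_ncard hsub (Set.finite_iUnion fun σ => hfin.image _)
    _ ≤ ∑ σ : Equiv.Perm (Fin (n + 3)),
        ((fun a : Fin (n + 3) → ℕ => a ∘ σ) '' sortedObstructions (n + 3) c).ncard := by
        exact Set.ncard_iUnion_le_of_fintype _
    _ ≤ ∑ _σ : Equiv.Perm (Fin (n + 3)), (e + 1) ^ (n + 2) * (2 * c) ^ e :=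
        Finset.sum_le_sum fun σ _ => (Set.ncard_image_le hfin).trans hcard
    _ = _ := by
        rw [Finset.sum_const, Finset.card_univ, Fintype.card_perm, Fintype.card_fin, smul_eq_mul,
          mul_pow]
        ring
end
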